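/- Let Ω = [0,1]^d with |Ω| = 1 and α > 0. Let μ : [0,1] × Ω → ℝ be C¹ with μ ≥ 0 and Φ : [0,1] × Ω → ℝ be C² with ∇_x Φ(t,x)·n(x) = 0 on the boundary of Ω, satisfying for all (t,x) ∈ [0,1] × Ω: ∂_t μ(t,x) + ∇·(μ(t,x) ∇_x Φ(t,x)) = α ∫_Ω Φ(t,y) dy and ∂_t Φ(t,x) + (1/2)‖∇_x Φ(t,x)‖² = 0. Set μ₀ = μ(0,·), μ₁ = μ(1,·), f(t) = α ∫_Ω Φ(t,y) dy. Then ∫₀¹ ∫_Ω (1/2)‖∇_x Φ(t,x)‖² μ(t,x) dx dt + (1/(2α)) ∫₀¹ f(t)² dt = ∫_Ω Φ(1,x) μ₁(x) dx − ∫_Ω Φ(0,x) μ₀(x) dx − (α/2) ∫₀¹ (∫_Ω Φ(t,x) dx)² dt. -/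

import Mathlib

open MeasureTheory

/-- The unit cube `Ω = [0,1]^d` in `ℝ^d` (with `|Ω| = 1`). -/
def cube (d : ℕ) : Set (EuclideanSpace ℝ (Fin d)) :=
  {x | ∀ i, x i ∈ Set.Icc (0:ℝ) 1}

/-- The (spatial) divergence of a vector field `w` on `ℝ^d` at a point `x`. -/
noncomputable def diverg {d : ℕ}
    (w : EuclideanSpace ℝ (Fin d) → EuclideanSpace ℝ (Fin d))
    (x : EuclideanSpace ℝ (Fin d)) : ℝ :=
  ∑ i, fderiv ℝ w x (EuclideanSpace.single i 1) i

lemma isCompact_cube (d : ℕ) : IsCompact (cube d) := by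
  have h : cube d = WithLp.toLp 2 '' Set.Icc (0 : Fin d → ℝ) 1 := by
    ext x
    constructor
    · intro hx
      exact ⟨WithLp.ofLp x, ⟨fun i => (hx i).1, fun i => (hx i).2⟩, rfl⟩
    · rintro ⟨y, hy, rfl⟩ i
      exact ⟨hy.1 i, hy.2 i⟩
  rw [h]
  exact isCompact_Icc.image (PiLp.continuous_toLp 2 _)

lemma setIntegral_cube_eq {d : ℕ} (g : EuclideanSpace ℝ (Fin d) → ℝ) :
    ∫ x in cube d, g x = ∫ y in Set.Icc (0 : Fin d → ℝ) 1, g (WithLp.toLp 2 y) := by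
  have h : Set.Icc (0 : Fin d → ℝ) 1 = WithLp.toLp 2 ⁻¹' cube d := by
    ext y
    exact ⟨fun hy i => ⟨hy.1 i, hy.2 i⟩, fun hy => ⟨fun i => (hy i).1, fun i => (hy i).2⟩⟩
  rw [h]
  exact ((PiLp.volume_preserving_toLp (Fin d)).setIntegral_preimage_emb
    (MeasurableEquiv.toLp 2 (Fin d → ℝ)).measurableEmbedding g (cube d)).symm

lemma continuous_diverg {d : ℕ}
    {w : EuclideanSpace ℝ (Fin d) → EuclideanSpace ℝ (Fin d)} (hw : ContDiff ℝ 1 w) :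
    Continuous (diverg w) := by
  have := hw.continuous_fderiv one_ne_zero
  unfold diverg
  fun_prop

/-- The divergence theorem on the unit cube, for fields tangent to the boundary. -/
lemma integral_diverg_eq_zero {d : ℕ}
    {w : EuclideanSpace ℝ (Fin d) → EuclideanSpace ℝ (Fin d)} (hw : ContDiff ℝ 1 w)
    (hflux : ∀ x ∈ cube d, ∀ i : Fin d, (x i = 0 ∨ x i = 1) → w x i = 0) :
    ∫ x in cube d, diverg w x = 0 := by
  cases d with
  | zero => simp [diverg]
  | succ n =>
    rw [setIntegral_cube_eq]
    let L := (PiLp.continuousLinearEquiv 2 ℝ (fun _ : Fin (n + 1) => ℝ))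
    have hL : ContDiff ℝ 1 (fun y : Fin (n + 1) → ℝ => L (w (L.symm y))) :=
      L.contDiff.comp (hw.comp L.symm.contDiff)
    let D (y : Fin (n + 1) → ℝ) : (Fin (n + 1) → ℝ) →L[ℝ] (Fin (n + 1) → ℝ) :=
      (L : _ →L[ℝ] _).comp ((fderiv ℝ w (L.symm y)).comp (L.symm : _ →L[ℝ] _))
    have hderiv : ∀ y, HasFDerivAt (fun y : Fin (n + 1) → ℝ => L (w (L.symm y))) (D y) y := by
      intro y
      exact L.hasFDerivAt.comp y (((hw.differentiable one_ne_zero _).hasFDerivAt).comp y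
        L.symm.hasFDerivAt)
    have hdiv : ∀ y : Fin (n + 1) → ℝ, diverg w (WithLp.toLp 2 y) =
        ∑ i, D y (Pi.single i 1) i := fun y => rfl
    have hcont : Continuous fun y : Fin (n + 1) → ℝ => diverg w (WithLp.toLp 2 y) :=
      (continuous_diverg hw).comp L.symm.continuous
    simp_rw [hdiv] at hcont ⊢
    rw [integral_divergence_of_hasFDerivAt_off_countable 0 1 zero_le_one _ _ ∅
      Set.countable_empty hL.continuous.continuousOn (fun y _ => hderiv y)
      (hcont.continuousOn.integrableOn_compact isCompact_Icc)]
    have hface : ∀ (i : Fin (n + 1)) (c : ℝ), (c = 0 ∨ c = 1) →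
        ∫ x in Set.Icc ((0 : Fin (n + 1) → ℝ) ∘ i.succAbove) ((1 : Fin (n + 1) → ℝ) ∘ i.succAbove),
          L (w (L.symm (i.insertNth c x))) i = 0 := by
      intro i c hc
      refine setIntegral_eq_zero_of_forall_eq_zero fun x hx => ?_
      refine hflux _ (fun j => ?_) i ?_
      · change i.insertNth (α := fun _ => ℝ) c x j ∈ Set.Icc (0 : ℝ) 1
        induction j using Fin.succAboveCases i with
        | x => rcases hc with rfl | rfl <;> simp
        | p j =>
          rw [Fin.insertNth_apply_succAbove]
          exact ⟨hx.1 j, hx.2 j⟩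
      · change i.insertNth (α := fun _ => ℝ) c x i = 0 ∨ i.insertNth (α := fun _ => ℝ) c x i = 1
        simpa using hc
    refine Finset.sum_eq_zero fun i _ => ?_
    have h0 := hface i 0 (Or.inl rfl)
    have h1 := hface i 1 (Or.inr rfl)
    exact (congrArg₂ (· - ·) h1 h0).trans (sub_zero 0)

lemma diverg_smul {d : ℕ} {g : EuclideanSpace ℝ (Fin d) → ℝ}
    {v : EuclideanSpace ℝ (Fin d) → EuclideanSpace ℝ (Fin d)} {x : EuclideanSpace ℝ (Fin d)}
    (hg : DifferentiableAt ℝ g x) (hv : DifferentiableAt ℝ v x) :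
    diverg (fun y => g y • v y) x = g x * diverg v x + fderiv ℝ g x (v x) := by
  have hvx : v x = ∑ i, v x i • EuclideanSpace.single i (1 : ℝ) := by
    ext j
    simp [Pi.single_apply]
  conv_rhs => rw [hvx]
  simp only [diverg, fderiv_fun_smul hg hv, map_sum, map_smul, Finset.mul_sum,
    ← Finset.sum_add_distrib]
  refine Finset.sum_congr rfl fun i _ => ?_
  simp [mul_comm]

lemma fderiv_apply_gradient {E : Type*} [NormedAddCommGroup E] [InnerProductSpace ℝ E]
    [CompleteSpace E] (g : E → ℝ) (x : E) :
    fderiv ℝ g x (gradient g x) = ‖gradient g x‖ ^ 2 := by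
  rw [← real_inner_self_eq_norm_sq]
  conv_rhs => arg 2; rw [gradient]
  rw [InnerProductSpace.toDual_symm_apply]

lemma gradient_apply_eq_fderiv {d : ℕ} (g : EuclideanSpace ℝ (Fin d) → ℝ)
    (x : EuclideanSpace ℝ (Fin d)) (i : Fin d) :
    gradient g x i = fderiv ℝ g x (EuclideanSpace.single i 1) := by
  rw [← InnerProductSpace.toDual_symm_apply (x := EuclideanSpace.single i 1)
    (y := fderiv ℝ g x), ← gradient, EuclideanSpace.inner_single_right]
  simp

lemma contDiff_gradient {d : ℕ} {Φ : ℝ → EuclideanSpace ℝ (Fin d) → ℝ}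
    (hΦ : ContDiff ℝ 2 (fun p : ℝ × EuclideanSpace ℝ (Fin d) => Φ p.1 p.2)) :
    ContDiff ℝ 1 (fun p : ℝ × EuclideanSpace ℝ (Fin d) => gradient (Φ p.1) p.2) := by
  rw [contDiff_euclidean]
  intro i
  simp_rw [gradient_apply_eq_fderiv]
  have h : ContDiff ℝ 2 (Function.uncurry
      fun (p : ℝ × EuclideanSpace ℝ (Fin d)) y => Φ p.1 y) :=
    hΦ.comp (contDiff_fst.fst.prodMk contDiff_snd)
  exact (h.fderiv (n := 1) contDiff_snd (by norm_num)).clm_apply contDiff_const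

/-- The fundamental theorem of calculus in time, integrated over a compact set in space. -/
lemma intervalIntegral_setIntegral_deriv {E : Type*} [NormedAddCommGroup E] [NormedSpace ℝ E]
    [MeasureSpace E] [BorelSpace E] [SecondCountableTopology E]
    [IsLocallyFiniteMeasure (volume : Measure E)] [SFinite (volume : Measure E)]
    {s : Set E} (hs : IsCompact s) {g : ℝ → E → ℝ}
    (hg : ContDiff ℝ 1 (fun p : ℝ × E => g p.1 p.2)) :
    ∫ t in (0:ℝ)..1, ∫ x in s, deriv (fun r => g r x) t =
      (∫ x in s, g 1 x) - ∫ x in s, g 0 x := by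
  have hdiff : ∀ x, ContDiff ℝ 1 fun r => g r x := fun x =>
    hg.comp (contDiff_id.prodMk contDiff_const)
  have hcont : Continuous (Function.uncurry fun (t : ℝ) x => deriv (fun r => g r x) t) := by
    have h : ContDiff ℝ 1 (Function.uncurry fun (p : ℝ × E) r => g r p.2) :=
      hg.comp (contDiff_snd.prodMk contDiff_fst.snd)
    exact ((h.fderiv (n := 0) contDiff_fst (by norm_num)).clm_apply
      (contDiff_const (c := (1 : ℝ)))).continuous
  have hint : ∀ r, IntegrableOn (g r) s := fun r =>
    (hg.continuous.comp (by fun_prop : Continuous fun x : E => (r, x))).continuousOn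
      |>.integrableOn_compact hs
  rw [intervalIntegral_integral_swap, ← integral_sub (hint 1) (hint 0)]
  · refine integral_congr_ae (Filter.Eventually.of_forall fun x => ?_)
    exact intervalIntegral.integral_deriv_eq_sub
      (fun t _ => (hdiff x).differentiable one_ne_zero t)
      (((hdiff x).continuous_deriv le_rfl).intervalIntegrable _ _)
  · rw [Measure.prod_restrict]
    exact (hcont.continuousOn.integrableOn_compact (isCompact_uIcc.prod hs)).mono_set
      (Set.prod_mono Set.uIoc_subset_uIcc le_rfl)

/-- Zero primal–dual gap for the optimality system of L² unnormalized
optimal transport on the unit cube: if `μ, Φ` solve the continuity equation with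
velocity `∇_x Φ` and source `f(t) = α ∫_Ω Φ(t,·)`, coupled with the Hamilton–Jacobi
equation, then the primal cost equals the dual Kantorovich value. -/
theorem stmt13 {d : ℕ} (α : ℝ) (hα : 0 < α)
    (μ : ℝ → EuclideanSpace ℝ (Fin d) → ℝ)
    (Φ : ℝ → EuclideanSpace ℝ (Fin d) → ℝ)
    (hμ : ContDiff ℝ 1 (fun p : ℝ × EuclideanSpace ℝ (Fin d) => μ p.1 p.2))
    (hμnonneg : ∀ t ∈ Set.Icc (0:ℝ) 1, ∀ x ∈ cube d, 0 ≤ μ t x)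
    (hΦ : ContDiff ℝ 2 (fun p : ℝ × EuclideanSpace ℝ (Fin d) => Φ p.1 p.2))
    (hΦflux : ∀ t ∈ Set.Icc (0:ℝ) 1, ∀ x ∈ cube d, ∀ i : Fin d,
      (x i = 0 ∨ x i = 1) → gradient (Φ t) x i = 0)
    (hpde : ∀ t ∈ Set.Icc (0:ℝ) 1, ∀ x ∈ cube d,
      deriv (fun s => μ s x) t + diverg (fun y => μ t y • gradient (Φ t) y) x
        = α * ∫ y in cube d, Φ t y)
    (hHJ : ∀ t ∈ Set.Icc (0:ℝ) 1, ∀ x ∈ cube d,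
      deriv (fun s => Φ s x) t + (1/2) * ‖gradient (Φ t) x‖^2 = 0)
    (f : ℝ → ℝ) (hfdef : ∀ t, f t = α * ∫ y in cube d, Φ t y) :
    (∫ t in (0:ℝ)..1, ∫ x in cube d, (1/2) * ‖gradient (Φ t) x‖^2 * μ t x)
        + (1/(2*α)) * ∫ t in (0:ℝ)..1, (f t)^2
      = (∫ x in cube d, Φ 1 x * μ 1 x) - (∫ x in cube d, Φ 0 x * μ 0 x)
        - (α/2) * ∫ t in (0:ℝ)..1, (∫ x in cube d, Φ t x)^2 := by
  have hG := contDiff_gradient hΦ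
  have hgrad : ∀ t, ContDiff ℝ 1 (gradient (Φ t)) := fun t =>
    hG.comp (contDiff_const.prodMk contDiff_id)
  have hΦx : ∀ t, ContDiff ℝ 1 (Φ t) := fun t =>
    (hΦ.of_le one_le_two).comp (contDiff_const.prodMk contDiff_id)
  have hμx : ∀ t, ContDiff ℝ 1 (μ t) := fun t => hμ.comp (contDiff_const.prodMk contDiff_id)
  have hΦt : ∀ x, ContDiff ℝ 1 fun s => Φ s x := fun x =>
    (hΦ.of_le one_le_two).comp (contDiff_id.prodMk contDiff_const)
  have hμt : ∀ x, ContDiff ℝ 1 fun s => μ s x := fun x =>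
    hμ.comp (contDiff_id.prodMk contDiff_const)
  have hK := isCompact_cube d
  have hkin : Continuous (Function.uncurry
      fun t x => (1/2) * ‖gradient (Φ t) x‖^2 * μ t x) :=
    (continuous_const.mul (hG.continuous.norm.pow 2)).mul hμ.continuous
  have hkin_int : Continuous fun t => ∫ x in cube d, (1/2) * ‖gradient (Φ t) x‖^2 * μ t x :=
    continuous_parametric_integral_of_continuous hkin hK
  have hΦ_int : Continuous fun t => ∫ x in cube d, Φ t x :=
    continuous_parametric_integral_of_continuous (f := Φ) hΦ.continuous hK
  have hslice : ∀ t ∈ Set.Icc (0:ℝ) 1,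
      ∫ x in cube d, deriv (fun s => Φ s x * μ s x) t =
        (∫ x in cube d, (1/2) * ‖gradient (Φ t) x‖^2 * μ t x)
          + α * (∫ x in cube d, Φ t x)^2 := by
    intro t ht
    have hw : ContDiff ℝ 1 fun y => Φ t y • μ t y • gradient (Φ t) y :=
      (hΦx t).smul ((hμx t).smul (hgrad t))
    have hpt : ∀ x ∈ cube d, deriv (fun s => Φ s x * μ s x) t =
        (1/2) * ‖gradient (Φ t) x‖^2 * μ t x + (α * ∫ y in cube d, Φ t y) * Φ t x
          - diverg (fun y => Φ t y • μ t y • gradient (Φ t) y) x := by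
      intro x hx
      rw [deriv_fun_mul ((hΦt x).differentiable one_ne_zero t)
          ((hμt x).differentiable one_ne_zero t),
        diverg_smul (v := fun y => μ t y • gradient (Φ t) y)
          ((hΦx t).differentiable one_ne_zero x)
          (((hμx t).smul (hgrad t)).differentiable one_ne_zero x),
        map_smul, fderiv_apply_gradient, smul_eq_mul]
      linear_combination μ t x * hHJ t ht x hx + Φ t x * hpde t ht x hx
    have hdiv : ∫ x in cube d, diverg (fun y => Φ t y • μ t y • gradient (Φ t) y) x = 0 :=
      integral_diverg_eq_zero hw fun x hx i hi => by simp [hΦflux t ht x hx i hi]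
    have hdiv_int : IntegrableOn
        (diverg fun y => Φ t y • μ t y • gradient (Φ t) y) (cube d) :=
      (continuous_diverg hw).continuousOn.integrableOn_compact hK
    have hkin_t : IntegrableOn (fun x => (1/2) * ‖gradient (Φ t) x‖^2 * μ t x) (cube d) :=
      (hkin.comp (Continuous.prodMk_right t)).continuousOn.integrableOn_compact hK
    have hΦ_t : IntegrableOn (fun x => (α * ∫ y in cube d, Φ t y) * Φ t x) (cube d) :=
      ((hΦx t).continuous.continuousOn.integrableOn_compact hK).const_mul _
    rw [setIntegral_congr_fun hK.measurableSet hpt, integral_sub (Integrable.fun_add hkin_t hΦ_t) hdiv_int,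
      integral_add hkin_t hΦ_t, hdiv, integral_const_mul]
    ring
  have hFTC := intervalIntegral_setIntegral_deriv hK
    (g := fun t x => Φ t x * μ t x) ((hΦ.of_le one_le_two).mul hμ)
  rw [intervalIntegral.integral_congr
      (fun t ht => hslice t (by rwa [Set.uIcc_of_le zero_le_one] at ht)),
    intervalIntegral.integral_add (hkin_int.intervalIntegrable _ _)
      ((by fun_prop : Continuous fun t => α * (∫ x in cube d, Φ t x)^2).intervalIntegrable _ _),
    intervalIntegral.integral_const_mul] at hFTC
  simp_rw [hfdef, mul_pow]
  rw [intervalIntegral.integral_const_mul, ← hFTC]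
  field_simp
  ring
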